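/- (Benign global geometry of the empirical problem.) There exist positive absolute constants c₁ and C₁ such that the following holds. Let x₁,…,x_L ∈ ℝ^N be i.i.d. Bernoulli–Gaussian vectors with parameter θ ∈ (1/N, 1/2), set y_i = x_i, f(d) = −(1/L) Σ_{i=1}^L |dᵀy_i|³, and fix ζ₀ ∈ (0,1) and δ ∈ (0, c₁/(N log(L) log(NL) θ^{1/3})^{3/2}). Whenever L ≥ C₁ δ^{−2} N θ log(Nθ/δ), with probability at least 1 − L^{−1} the following holds simultaneously for all 2N good subsets S_{ζ₀}^{(n±)} (stated for S_{ζ₀}^{(N+)}): for all d ∈ S_{ζ₀}^{(N+)} and all n' ≠ N with d_{n'} ≠ 0, ⟨ −(I − d dᵀ)∇f(d), (1/d_N) e_N − (1/d_{n'}) e_{n'} ⟩ ≥ (3γ₃/(2N)) θ(1−θ) ζ₀/(1+ζ₀) − δ ‖(1/d_{n'}) e_{n'} − (1/d_N) e_N‖. -/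

import Mathlib

open MeasureTheory ProbabilityTheory Real

/-- The Bernoulli–Gaussian distribution BG(θ) on ℝ. -/
noncomputable def bgMeasure (θ : ℝ) : Measure ℝ :=
  (1 - θ).toNNReal • Measure.dirac 0 + θ.toNNReal • gaussianReal 0 1

instance (θ : ℝ) : IsFiniteMeasure (bgMeasure θ) := by
  unfold bgMeasure; infer_instance

/-- The law of a Bernoulli–Gaussian random vector x ∈ ℝ^N with i.i.d. BG(θ) coordinates. -/
noncomputable def bgPi (θ : ℝ) (N : ℕ) : Measure (Fin N → ℝ) :=
  Measure.pi fun _ => bgMeasure θ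

/-- The joint law of L i.i.d. samples y_i = x_i, x_i ~ BG(θ)^N (dictionary D* = I). -/
noncomputable def bgSamples (θ : ℝ) (N L : ℕ) : Measure (Fin L → Fin N → ℝ) :=
  Measure.pi fun _ => bgPi θ N

/-- γ₃ = 2√(2/π). -/
noncomputable def gammaThree : ℝ := 2 * Real.sqrt (2 / π)

/-- (3/L) Σᵢ (dᵀyᵢ)|dᵀyᵢ| (yᵢ)_j = −∇f(d)_j for the empirical objective
f(d) = −(1/L)Σᵢ|dᵀyᵢ|³. -/
noncomputable def empG (N L : ℕ) (ω : Fin L → Fin N → ℝ) (d : Fin N → ℝ)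
    (j : Fin N) : ℝ :=
  ((3 : ℝ) / L) * ∑ i, (∑ k, d k * ω i k) * |∑ k, d k * ω i k| * ω i j

/-- The j-th coordinate of the negative Riemannian gradient −(I − ddᵀ)∇f(d) of the
empirical objective. -/
noncomputable def empNegRGrad (N L : ℕ) (ω : Fin L → Fin N → ℝ) (d : Fin N → ℝ)
    (j : Fin N) : ℝ :=
  empG N L ω d j - d j * ∑ k, d k * empG N L ω d k

/-- Membership in the good subset S_ζ^{(n,s)} (s = +1 or −1): d is a unit vector,
s·d_n > 0, and d_n²/‖d_{−n}‖_∞² ≥ 1+ζ, i.e. (1+ζ) d_j² ≤ d_n² for all j ≠ n. -/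
def goodSet (N : ℕ) (ζ : ℝ) (n : Fin N) (s : ℝ) (d : Fin N → ℝ) : Prop :=
  (∑ i, d i ^ 2 = 1) ∧ 0 < s * d n ∧ ∀ j ≠ n, (1 + ζ) * d j ^ 2 ≤ d n ^ 2



lemma bg_isProb {θ : ℝ} (h0 : 0 ≤ θ) (h1 : θ ≤ 1) : IsProbabilityMeasure (bgMeasure θ) := by
  constructor
  unfold bgMeasure
  simp only [Measure.coe_add, Measure.coe_nnreal_smul_apply, Pi.add_apply, measure_univ, mul_one]
  rw [← ENNReal.coe_add, ← Real.toNNReal_add (by linarith) h0]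
  simp

lemma integrable_bg {θ : ℝ} {f : ℝ → ℝ} (hf : Integrable f (gaussianReal 0 1)) :
    Integrable f (bgMeasure θ) := by
  unfold bgMeasure
  refine Integrable.add_measure ?_ ?_
  · exact (integrable_dirac (by simp)).smul_measure_nnreal
  · exact hf.smul_measure_nnreal

lemma integral_bg {θ : ℝ} (h0 : 0 ≤ θ) (h1 : θ ≤ 1) {f : ℝ → ℝ}
    (hf : Integrable f (gaussianReal 0 1)) :
    ∫ x, f x ∂bgMeasure θ = (1 - θ) * f 0 + θ * ∫ x, f x ∂gaussianReal 0 1 := by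
  unfold bgMeasure
  rw [integral_add_measure, integral_smul_nnreal_measure, integral_smul_nnreal_measure,
    integral_dirac]
  · simp [NNReal.smul_def, h0, h1]
  · exact (integrable_dirac (by simp)).smul_measure_nnreal
  · exact hf.smul_measure_nnreal

lemma integrable_gauss_iff {f : ℝ → ℝ} (hf : Integrable (fun x => gaussianPDFReal 0 1 x * f x)) :
    Integrable f (gaussianReal 0 1) := by
  rw [gaussianReal_of_var_ne_zero 0 one_ne_zero,
    integrable_withDensity_iff (measurable_gaussianPDF 0 1) (by simp [gaussianPDF])]
  simpa [toReal_gaussianPDF, mul_comm] using hf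

lemma pdf_mul_exp (x : ℝ) : gaussianPDFReal 0 1 x * exp (3 / 8 * x ^ 2)
    = (√(2 * π))⁻¹ * exp (-(1/8) * x ^ 2) := by
  simp only [gaussianPDFReal, NNReal.coe_one, mul_one, sub_zero]
  rw [mul_assoc, ← exp_add]
  congr 2; ring

lemma integrable_gauss_exp : Integrable (fun x => exp (3 / 8 * x ^ 2)) (gaussianReal 0 1) := by
  apply integrable_gauss_iff
  simp_rw [pdf_mul_exp]
  exact (integrable_exp_neg_mul_sq (by norm_num)).const_mul _

lemma integral_gauss_exp : ∫ x, exp (3 / 8 * x ^ 2) ∂(gaussianReal 0 1) = 2 := by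
  rw [integral_gaussianReal_eq_integral_smul one_ne_zero]
  simp_rw [smul_eq_mul, pdf_mul_exp]
  rw [integral_const_mul, integral_gaussian]
  rw [show π / (1/8) = (2 * 2) * (2 * π) by ring, Real.sqrt_mul (show (0:ℝ) ≤ 2 * 2 by norm_num),
    Real.sqrt_mul_self (by norm_num)]
  have : √(2 * π) ≠ 0 := by positivity
  field_simp

lemma bg_mgf {θ : ℝ} (h0 : 0 ≤ θ) (h1 : θ ≤ 1) (s : ℝ) :
    ∫ x, exp (s * x) ∂bgMeasure θ ≤ exp (s ^ 2 / 2) := by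
  rw [integral_bg h0 h1 (integrable_exp_mul_gaussianReal s)]
  have h := congrFun (mgf_id_gaussianReal (μ := 0) (v := 1)) s
  simp only [mgf, id] at h
  rw [h]
  have : 1 ≤ exp (s ^ 2 / 2) := by rw [Real.one_le_exp_iff]; positivity
  simp
  nlinarith

lemma sq_exp_bound (s x : ℝ) (hs : |s| ≤ 1) : x ^ 2 * exp (s * x) ≤ 24 * exp (3 / 8 * x ^ 2) := by
  have h1 : x ^ 2 ≤ 8 * exp (x ^ 2 / 8) := by
    have := Real.add_one_le_exp (x ^ 2 / 8); linarith
  have h2 : s * x ≤ 1 + x ^ 2 / 4 := by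
    have : s * x ≤ |x| := by
      calc s * x ≤ |s * x| := le_abs_self _
        _ = |s| * |x| := abs_mul _ _
        _ ≤ 1 * |x| := by gcongr
        _ = |x| := one_mul _
    nlinarith [sq_nonneg (|x| - 2), sq_abs x]
  calc x ^ 2 * exp (s * x) ≤ (8 * exp (x ^ 2 / 8)) * exp (1 + x ^ 2 / 4) := by gcongr
    _ = 8 * exp 1 * exp (3 / 8 * x ^ 2) := by
      rw [mul_assoc, mul_assoc, ← exp_add, ← exp_add]; congr 2; ring
    _ ≤ 24 * exp (3 / 8 * x ^ 2) := by
      have := Real.exp_one_lt_d9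
      gcongr; linarith

lemma integrable_sq_exp (s : ℝ) (hs : |s| ≤ 1) :
    Integrable (fun x => x ^ 2 * exp (s * x)) (gaussianReal 0 1) := by
  refine (integrable_gauss_exp.const_mul 24).mono' (by fun_prop) (.of_forall fun x => ?_)
  rw [Real.norm_of_nonneg (by positivity)]
  exact sq_exp_bound s x hs

lemma bg_sq_exp {θ : ℝ} (h0 : 0 ≤ θ) (h1 : θ ≤ 1) (s : ℝ) (hs : |s| ≤ 1) :
    ∫ x, x ^ 2 * exp (s * x) ∂bgMeasure θ ≤ 48 * θ := by
  rw [integral_bg h0 h1 (integrable_sq_exp s hs)]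
  have : ∫ x, x ^ 2 * exp (s * x) ∂gaussianReal 0 1 ≤ 24 * 2 := by
    rw [← integral_gauss_exp, ← integral_const_mul]
    exact integral_mono (integrable_sq_exp s hs) (integrable_gauss_exp.const_mul _)
      fun x => sq_exp_bound s x hs
  norm_num at this ⊢
  nlinarith

lemma bg_exp {θ : ℝ} (h0 : 0 ≤ θ) (h1 : θ ≤ 1) :
    ∫ x, exp (3 / 8 * x ^ 2) ∂bgMeasure θ ≤ exp θ := by
  rw [integral_bg h0 h1 integrable_gauss_exp, integral_gauss_exp]
  have := Real.add_one_le_exp θ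
  norm_num; linarith

lemma integral_abs_cube : ∫ x, |x| ^ 3 ∂(gaussianReal 0 1) = gammaThree := by
  rw [integral_gaussianReal_eq_integral_smul one_ne_zero]
  have h1 : ∀ x : ℝ, gaussianPDFReal 0 1 x • |x| ^ 3
      = (fun y => (√(2 * π))⁻¹ * (y ^ (3:ℝ) * exp (-(1/2) * y ^ (2:ℝ)))) |x| := by
    intro x
    simp only [gaussianPDFReal, NNReal.coe_one, mul_one, sub_zero, smul_eq_mul]
    rw [show ((3:ℝ)) = ((3:ℕ):ℝ) by norm_num, show ((2:ℝ)) = ((2:ℕ):ℝ) by norm_num]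
    simp only [Real.rpow_natCast, sq_abs]
    push_cast
    rw [show -(1/2) * x ^ 2 = - x ^ 2 / 2 by ring]; ring
  simp_rw [h1]
  rw [integral_comp_abs (f := fun y => (√(2 * π))⁻¹ * (y ^ (3:ℝ) * exp (-(1/2) * y ^ (2:ℝ)))),
    integral_const_mul, integral_rpow_mul_exp_neg_mul_rpow (by norm_num) (by norm_num) (by norm_num)]
  norm_num
  rw [gammaThree, Real.sqrt_div (by norm_num)]
  have h2 : √π ≠ 0 := by positivity
  have h3 : √2 * √2 = (2:ℝ) := Real.mul_self_sqrt (by norm_num)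
  field_simp
  linarith


lemma bgPi_isProb {θ : ℝ} (h0 : 0 ≤ θ) (h1 : θ ≤ 1) (N : ℕ) : IsProbabilityMeasure (bgPi θ N) := by
  have := bg_isProb h0 h1
  unfold bgPi; infer_instance

lemma bgSamples_isProb {θ : ℝ} (h0 : 0 ≤ θ) (h1 : θ ≤ 1) (N L : ℕ) :
    IsProbabilityMeasure (bgSamples θ N L) := by
  have := bgPi_isProb h0 h1 N
  unfold bgSamples; infer_instance

/-- squared Euclidean norm -/
noncomputable def qn {N : ℕ} (x : Fin N → ℝ) : ℝ := ∑ k, x k ^ 2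

/-- dot product -/
noncomputable def dt {N : ℕ} (d x : Fin N → ℝ) : ℝ := ∑ k, d k * x k

lemma qn_nonneg {N : ℕ} (x : Fin N → ℝ) : 0 ≤ qn x := Finset.sum_nonneg fun _ _ => sq_nonneg _

@[fun_prop] lemma continuous_qn {N : ℕ} : Continuous (qn (N := N)) := by unfold qn; fun_prop
@[fun_prop] lemma continuous_dt {N : ℕ} (d : Fin N → ℝ) : Continuous (dt d) := by
  unfold dt; fun_prop

lemma dt_abs_le {N : ℕ} (d x : Fin N → ℝ) : |dt d x| ≤ √(qn d) * √(qn x) := by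
  rw [← Real.sqrt_mul (qn_nonneg d)]
  exact Real.abs_le_sqrt (Finset.sum_mul_sq_le_sq_mul_sq _ _ _)

lemma coord_abs_le {N : ℕ} (x : Fin N → ℝ) (n : Fin N) : |x n| ≤ √(qn x) :=
  Real.abs_le_sqrt (Finset.single_le_sum (f := fun k => x k ^ 2) (fun _ _ => sq_nonneg _)
    (Finset.mem_univ n))

lemma integrable_exp_qn (θ : ℝ) (N : ℕ) :
    Integrable (fun x => exp (3 / 8 * qn x)) (bgPi θ N) := by
  have : (fun x : Fin N → ℝ => exp (3 / 8 * qn x)) = fun x => ∏ k, exp (3 / 8 * x k ^ 2) := by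
    ext x; rw [← exp_sum, qn, Finset.mul_sum]
  rw [this]
  exact Integrable.fintype_prod (f := fun (_ : Fin N) (y:ℝ) => exp (3 / 8 * y ^ 2))
    (fun _ => integrable_bg integrable_gauss_exp)

lemma integral_exp_qn {θ : ℝ} (h0 : 0 ≤ θ) (h1 : θ ≤ 1) (N : ℕ) :
    ∫ x, exp (3 / 8 * qn x) ∂(bgPi θ N) ≤ exp (N * θ) := by
  have : (fun x : Fin N → ℝ => exp (3 / 8 * qn x)) = fun x => ∏ k, exp (3 / 8 * x k ^ 2) := by
    ext x; rw [← exp_sum, qn, Finset.mul_sum]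
  rw [this, bgPi, integral_fintype_prod_eq_prod (f := fun (_ : Fin N) (y:ℝ) => exp (3 / 8 * y ^ 2))]
  rw [Finset.prod_const, Finset.card_univ, Fintype.card_fin, exp_nat_mul]
  exact pow_le_pow_left₀ (integral_nonneg fun x => (exp_pos _).le) (bg_exp h0 h1) _

lemma sqrt_cube_le {q : ℝ} (hq : 0 ≤ q) : √q ^ 3 ≤ 128 * exp (q / 8) := by
  have h1 := Real.quadratic_le_exp_of_nonneg (show 0 ≤ q / 8 by positivity)
  have h2 := Real.sq_sqrt hq
  have h3 := Real.sqrt_nonneg q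
  have : √q ^ 3 = q * √q := by rw [pow_succ, h2]
  nlinarith [sq_nonneg (√q - 1), mul_nonneg hq h3]

lemma integrable_cube (θ : ℝ) (N : ℕ) : Integrable (fun x => √(qn x) ^ 3) (bgPi θ N) := by
  refine ((integrable_exp_qn θ N).const_mul 128).mono' (by fun_prop) (.of_forall fun x => ?_)
  rw [Real.norm_of_nonneg (by positivity)]
  refine (sqrt_cube_le (qn_nonneg x)).trans ?_
  have := qn_nonneg x
  gcongr; linarith

/-- z|z| x_n -/
noncomputable def Ff {N : ℕ} (d : Fin N → ℝ) (n : Fin N) (x : Fin N → ℝ) : ℝ :=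
  dt d x * |dt d x| * x n

@[fun_prop] lemma continuous_Ff {N : ℕ} (d : Fin N → ℝ) (n : Fin N) : Continuous (Ff d n) := by
  unfold Ff; fun_prop

lemma Ff_abs_le {N : ℕ} (d : Fin N → ℝ) (n : Fin N) (x : Fin N → ℝ) :
    |Ff d n x| ≤ qn d * √(qn x) ^ 3 := by
  unfold Ff
  rw [abs_mul, abs_mul, abs_abs]
  have h1 := dt_abs_le d x
  have h2 := coord_abs_le x n
  calc |dt d x| * |dt d x| * |x n| ≤ (√(qn d) * √(qn x)) * (√(qn d) * √(qn x)) * √(qn x) := by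
        gcongr
    _ = √(qn d) ^ 2 * √(qn x) ^ 3 := by ring
    _ = _ := by rw [Real.sq_sqrt (qn_nonneg d)]

lemma integrable_Ff {N : ℕ} (θ : ℝ) (d : Fin N → ℝ) (n : Fin N) : Integrable (Ff d n) (bgPi θ N) :=
  ((integrable_cube θ N).const_mul (qn d)).mono' (by fun_prop)
    (.of_forall fun x => Ff_abs_le d n x)

/-- second moment bound -/
lemma exp_dt_sq {N : ℕ} {θ : ℝ} (h0 : 0 ≤ θ) (h1 : θ ≤ 1) (d : Fin N → ℝ) (hd : qn d ≤ 1)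
    (n : Fin N) : Integrable (fun x => exp (dt d x) * x n ^ 2) (bgPi θ N) ∧
      ∫ x, exp (dt d x) * x n ^ 2 ∂(bgPi θ N) ≤ 96 * θ := by
  have hdn : |d n| ≤ 1 := (coord_abs_le d n).trans (Real.sqrt_le_iff.mpr ⟨zero_le_one, by simpa using hd⟩)
  set g : Fin N → ℝ → ℝ := fun k y => if k = n then y ^ 2 * exp (d k * y) else exp (d k * y) with hg
  have e : (fun x : Fin N → ℝ => exp (dt d x) * x n ^ 2) = fun x => ∏ k, g k (x k) := by
    ext x
    have : ∀ k, g k (x k) = exp (d k * x k) * (if k = n then x k ^ 2 else 1) := by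
      intro k; simp only [hg]; split_ifs <;> ring
    simp_rw [this, Finset.prod_mul_distrib, ← exp_sum]
    simp [dt]
  have gi : ∀ k, Integrable (g k) (bgMeasure θ) := by
    intro k
    by_cases hk : k = n
    · simp only [hg, hk, if_true]
      exact integrable_bg (integrable_sq_exp _ hdn)
    · simp only [hg, hk, if_false]
      exact integrable_bg (integrable_exp_mul_gaussianReal _)
  rw [e]
  refine ⟨Integrable.fintype_prod gi, ?_⟩
  rw [bgPi, integral_fintype_prod_eq_prod]
  have gb : ∀ k, ∫ y, g k y ∂(bgMeasure θ) ≤ exp (d k ^ 2 / 2) * (if k = n then 48 * θ else 1) := by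
    intro k
    by_cases hk : k = n
    · simp only [hg, hk, if_true]
      refine (bg_sq_exp h0 h1 _ hdn).trans ?_
      have : 1 ≤ exp (d n ^ 2 / 2) := by rw [Real.one_le_exp_iff]; positivity
      nlinarith
    · simp only [hg, hk, if_false, mul_one]
      exact bg_mgf h0 h1 _
  calc ∏ k, ∫ y, g k y ∂(bgMeasure θ)
      ≤ ∏ k, exp (d k ^ 2 / 2) * (if k = n then 48 * θ else 1) := by
        refine Finset.prod_le_prod (fun k _ => integral_nonneg fun y => ?_) fun k _ => gb k
        simp only [hg]; simp only [Pi.zero_apply]; split_ifs <;> positivity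
    _ = exp (qn d / 2) * (48 * θ) := by
        rw [Finset.prod_mul_distrib, ← exp_sum, qn, Finset.sum_div]; simp
    _ ≤ 2 * (48 * θ) := by
        have : exp (qn d / 2) ≤ 2 := by
          calc exp (qn d / 2) ≤ exp (1/2) := by gcongr
            _ ≤ 2 := by
              have h := Real.exp_one_lt_d9
              have h' : exp (1/2) * exp (1/2) = exp 1 := by rw [← exp_add]; norm_num
              nlinarith [exp_pos (1/2)]
        gcongr
    _ = 96 * θ := by ring

lemma dt_neg {N : ℕ} (d x : Fin N → ℝ) : dt (-d) x = - dt d x := by simp [dt]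
lemma qn_neg {N : ℕ} (d : Fin N → ℝ) : qn (-d) = qn d := by simp [qn]

lemma four_le_exp (z : ℝ) : z ^ 4 ≤ 24 * (exp z + exp (-z)) := by
  have key : ∀ y : ℝ, 0 ≤ y → y ^ 4 ≤ 24 * exp y := by
    intro y hy
    have := Real.pow_div_factorial_le_exp y hy 4
    norm_num [Nat.factorial] at this
    linarith
  rcases le_total 0 z with h | h
  · have := key z h; have := exp_pos (-z); linarith
  · have := key (-z) (by linarith); have := exp_pos z
    have e : (-z)^4 = z^4 := by ring
    linarith

lemma second_moment {N : ℕ} {θ : ℝ} (h0 : 0 ≤ θ) (h1 : θ ≤ 1) (d : Fin N → ℝ) (hd : qn d ≤ 1)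
    (n : Fin N) : Integrable (fun x => Ff d n x ^ 2) (bgPi θ N) ∧
      ∫ x, Ff d n x ^ 2 ∂(bgPi θ N) ≤ 5000 * θ := by
  obtain ⟨i1, b1⟩ := exp_dt_sq h0 h1 d hd n
  obtain ⟨i2, b2⟩ := exp_dt_sq h0 h1 (-d) (by rwa [qn_neg]) n
  have hb : ∀ x, Ff d n x ^ 2 ≤ 24 * (exp (dt d x) * x n ^ 2 + exp (dt (-d) x) * x n ^ 2) := by
    intro x
    have := four_le_exp (dt d x)
    rw [dt_neg]
    calc Ff d n x ^ 2 = dt d x ^ 4 * x n ^ 2 := by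
          unfold Ff; rw [mul_pow, mul_pow, sq_abs]; ring
      _ ≤ (24 * (exp (dt d x) + exp (-dt d x))) * x n ^ 2 := by gcongr
      _ = _ := by ring
  have ii := (i1.add i2).const_mul 24
  have i3 : Integrable (fun x => Ff d n x ^ 2) (bgPi θ N) := by
    refine ii.mono' (by fun_prop) (.of_forall fun x => ?_)
    rw [Real.norm_of_nonneg (by positivity)]; exact hb x
  refine ⟨i3, (integral_mono i3 ii hb).trans ?_⟩
  rw [integral_const_mul]
  simp only [Pi.add_apply]
  rw [integral_add i1 i2]
  linarith


lemma charFun_bg {θ : ℝ} (h0 : 0 ≤ θ) (h1 : θ ≤ 1) (t : ℝ) :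
    ∫ x, Complex.exp (t * x * Complex.I) ∂bgMeasure θ
      = θ * Complex.exp (-(t ^ 2 / 2)) + (1 - θ) := by
  have hb : ∀ (μ : Measure ℝ) [IsFiniteMeasure μ],
      Integrable (fun x : ℝ => Complex.exp (t * x * Complex.I)) μ := by
    intro μ _
    refine Integrable.of_bound (C := 1) (by fun_prop) (.of_forall fun x => ?_)
    have := Complex.norm_exp_ofReal_mul_I (t * x)
    push_cast at this
    exact this.le
  unfold bgMeasure
  rw [integral_add_measure ((hb _).smul_measure_nnreal) ((hb _).smul_measure_nnreal),
    integral_smul_nnreal_measure, integral_smul_nnreal_measure,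
    integral_dirac, ← charFun_apply_real, charFun_gaussianReal]
  simp [NNReal.smul_def, h0, h1]
  ring

/-- weight of a support -/
noncomputable def pw (θ : ℝ) (N : ℕ) (A : Finset (Fin N)) : ℝ := θ ^ A.card * (1 - θ) ^ (N - A.card)

lemma pw_nonneg {θ : ℝ} (h0 : 0 ≤ θ) (h1 : θ ≤ 1) {N : ℕ} (A : Finset (Fin N)) : 0 ≤ pw θ N A := by
  have : 0 ≤ 1 - θ := by linarith
  unfold pw; positivity

lemma law_dt {θ : ℝ} (h0 : 0 ≤ θ) (h1 : θ ≤ 1) {N : ℕ} (d : Fin N → ℝ) :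
    (bgPi θ N).map (dt d) = ∑ A : Finset (Fin N), (pw θ N A).toNNReal •
      gaussianReal 0 (∑ k ∈ A, d k ^ 2).toNNReal := by
  have := bgPi_isProb h0 h1 N
  have hfin : IsFiniteMeasure (∑ A : Finset (Fin N), (pw θ N A).toNNReal •
      gaussianReal 0 (∑ k ∈ A, d k ^ 2).toNNReal) := by
    constructor
    rw [Measure.finsetSum_apply]
    exact ENNReal.sum_lt_top.mpr fun A _ => measure_lt_top _ _
  have hb : ∀ (μ : Measure ℝ) [IsFiniteMeasure μ] (t : ℝ),
      Integrable (fun x : ℝ => Complex.exp (t * x * Complex.I)) μ := by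
    intro μ _ t
    refine Integrable.of_bound (C := 1) (by fun_prop) (.of_forall fun x => ?_)
    have := Complex.norm_exp_ofReal_mul_I (t * x)
    push_cast at this
    exact this.le
  apply Measure.ext_of_charFun
  ext t
  rw [charFun_apply_real, charFun_apply_real, integral_map (by fun_prop) (by fun_prop),
    integral_finsetSum_measure (fun A _ => hb _ _)]
  simp_rw [integral_smul_nnreal_measure, ← charFun_apply_real, charFun_gaussianReal]
  have e : (fun x : Fin N → ℝ => Complex.exp (t * (dt d x : ℝ) * Complex.I))
      = fun x => ∏ k, Complex.exp ((t * d k : ℝ) * (x k : ℝ) * Complex.I) := by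
    ext x
    rw [← Complex.exp_sum]
    congr 1
    simp only [dt]
    push_cast
    rw [Finset.mul_sum, Finset.sum_mul]
    exact Finset.sum_congr rfl fun k _ => by ring
  rw [e, bgPi, integral_fintype_prod_eq_prod
    (f := fun (k : Fin N) (y : ℝ) => Complex.exp ((t * d k : ℝ) * (y : ℝ) * Complex.I))]
  simp_rw [charFun_bg h0 h1]
  rw [Fintype.prod_add]
  refine Finset.sum_congr rfl fun A _ => ?_
  rw [Finset.prod_mul_distrib, Finset.prod_const, Finset.prod_const, ← Complex.exp_sum,
    Finset.card_compl, Fintype.card_fin]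
  rw [NNReal.smul_def, Real.coe_toNNReal _ (pw_nonneg h0 h1 A),
    Real.coe_toNNReal _ (Finset.sum_nonneg fun k _ => sq_nonneg _), pw, Complex.real_smul]
  push_cast
  rw [mul_right_comm]
  congr 2
  rw [Finset.sum_mul, Finset.sum_div]
  rw [mul_zero, zero_mul, zero_sub, ← Finset.sum_neg_distrib]
  exact Finset.sum_congr rfl fun k _ => by ring

lemma integral_abs_cube_var {v : ℝ} (hv : 0 ≤ v) :
    Integrable (fun x => |x| ^ 3) (gaussianReal 0 v.toNNReal) ∧
    ∫ x, |x| ^ 3 ∂(gaussianReal 0 v.toNNReal) = gammaThree * √v ^ 3 := by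
  constructor
  · have := (memLp_id_gaussianReal (μ := 0) (v := v.toNNReal) 3).integrable_norm_pow (by norm_num)
    simpa using this
  · have h := gaussianReal_map_const_mul (μ := 0) (v := 1) (√v)
    have h2 : gaussianReal 0 v.toNNReal = (gaussianReal 0 1).map (√v * ·) := by
      rw [h, mul_zero, mul_one]
      congr 1
      ext; simp [Real.sq_sqrt hv, hv]
    rw [h2, integral_map (by fun_prop) (by fun_prop)]
    simp_rw [abs_mul, mul_pow, abs_of_nonneg (Real.sqrt_nonneg v)]
    rw [integral_const_mul, integral_abs_cube, mul_comm]

lemma integral_cube {θ : ℝ} (h0 : 0 ≤ θ) (h1 : θ ≤ 1) {N : ℕ} (d : Fin N → ℝ) :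
    ∫ x, |dt d x| ^ 3 ∂(bgPi θ N)
      = ∑ A : Finset (Fin N), pw θ N A * (gammaThree * √(∑ k ∈ A, d k ^ 2) ^ 3) := by
  have hv := fun A : Finset (Fin N) =>
    integral_abs_cube_var (v := ∑ k ∈ A, d k ^ 2) (Finset.sum_nonneg fun k _ => sq_nonneg _)
  have : ∫ x, |dt d x| ^ 3 ∂(bgPi θ N) = ∫ y, |y| ^ 3 ∂((bgPi θ N).map (dt d)) := by
    rw [integral_map (by fun_prop) (by fun_prop)]
  rw [this, law_dt h0 h1, integral_finsetSum_measure fun A _ => (hv A).1.smul_measure_nnreal]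
  refine Finset.sum_congr rfl fun A _ => ?_
  rw [integral_smul_nnreal_measure, (hv A).2, NNReal.smul_def, Real.coe_toNNReal _ (pw_nonneg h0 h1 A),
    smul_eq_mul]

lemma hasDerivAt_abs_cube (y : ℝ) : HasDerivAt (fun y : ℝ => |y| ^ 3) (3 * (y * |y|)) y := by
  rcases lt_trichotomy y 0 with h | h | h
  · have : (fun y : ℝ => |y| ^ 3) =ᶠ[nhds y] fun y => - y ^ 3 := by
      filter_upwards [eventually_lt_nhds h] with z hz
      rw [abs_of_neg hz]; ring
    refine HasDerivAt.congr_of_eventuallyEq ?_ this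
    rw [abs_of_neg h]
    exact (hasDerivAt_pow 3 y).fun_neg.congr_deriv (by push_cast; ring)
  · subst h
    simp only [abs_zero, mul_zero]
    rw [hasDerivAt_iff_isLittleO_nhds_zero]
    simp only [zero_add, abs_zero, smul_eq_mul, mul_zero, sub_zero, ne_eq, OfNat.ofNat_ne_zero,
      not_false_eq_true, zero_pow]
    have : (fun h : ℝ => |h| ^ 3) = fun h => ‖h ^ 3‖ := by ext h; simp
    rw [this, Asymptotics.isLittleO_norm_left]
    exact Asymptotics.isLittleO_pow_id (by norm_num)
  · have : (fun y : ℝ => |y| ^ 3) =ᶠ[nhds y] fun y => y ^ 3 := by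
      filter_upwards [eventually_gt_nhds h] with z hz
      rw [abs_of_pos hz]
    refine HasDerivAt.congr_of_eventuallyEq ?_ this
    rw [abs_of_pos h]
    exact (hasDerivAt_pow 3 y).congr_deriv (by push_cast; ring)

lemma dt_update {N : ℕ} (d : Fin N → ℝ) (n : Fin N) (s : ℝ) (x : Fin N → ℝ) :
    dt (Function.update d n s) x = dt d x + (s - d n) * x n := by
  unfold dt
  rw [← Finset.sum_erase_add _ _ (Finset.mem_univ n), 
    ← Finset.sum_erase_add (f := fun k => d k * x k) _ (Finset.mem_univ n)]
  have : ∑ k ∈ Finset.univ.erase n, Function.update d n s k * x k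
      = ∑ k ∈ Finset.univ.erase n, d k * x k :=
    Finset.sum_congr rfl fun k hk => by rw [Function.update_of_ne (Finset.ne_of_mem_erase hk)]
  rw [this, Function.update_self]; ring

lemma deriv_cube {θ : ℝ} (N : ℕ) (d : Fin N → ℝ) (n : Fin N) :
    HasDerivAt (fun s => ∫ x, |dt (Function.update d n s) x| ^ 3 ∂(bgPi θ N))
      (∫ x, 3 * Ff d n x ∂(bgPi θ N)) (d n) := by
  have key := hasDerivAt_integral_of_dominated_loc_of_deriv_le (μ := bgPi θ N)
    (F := fun s x => |dt (Function.update d n s) x| ^ 3)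
    (F' := fun s x => 3 * Ff (Function.update d n s) n x)
    (s := Metric.ball (d n) 1) (x₀ := d n)
    (bound := fun x => 3 * ((√(qn d) + 1) ^ 2 * √(qn x) ^ 3))
    (Metric.ball_mem_nhds _ one_pos) (.of_forall fun s => by fun_prop) ?_ (by fun_prop)
    (.of_forall fun x s hs => ?_) (((integrable_cube θ N).const_mul _).const_mul _)
    (.of_forall fun x s _ => ?_)
  · have := key.2
    simpa using this
  · refine ((integrable_cube θ N).const_mul (√(qn d) ^ 3)).mono' (by fun_prop)
      (.of_forall fun x => ?_)
    simp only [Function.update_eq_self, norm_pow, norm_abs_eq_norm, Real.norm_eq_abs]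
    rw [← mul_pow]
    exact pow_le_pow_left₀ (abs_nonneg _) (dt_abs_le d x) 3
  · have hz : |dt (Function.update d n s) x| ≤ (√(qn d) + 1) * √(qn x) := by
      rw [dt_update, add_mul]
      refine (abs_add_le _ _).trans (add_le_add (dt_abs_le d x) ?_)
      rw [abs_mul]
      rw [Metric.mem_ball, Real.dist_eq] at hs
      exact mul_le_mul hs.le (coord_abs_le x n) (abs_nonneg _) zero_le_one
    rw [Real.norm_eq_abs, abs_mul, Ff, abs_mul, abs_mul, abs_abs, abs_of_pos (by norm_num : (0:ℝ) < 3)]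
    calc 3 * (|dt (Function.update d n s) x| * |dt (Function.update d n s) x| * |x n|)
        ≤ 3 * (((√(qn d) + 1) * √(qn x)) * ((√(qn d) + 1) * √(qn x)) * √(qn x)) := by
          gcongr; exact coord_abs_le x n
      _ = _ := by ring
  · have h1 : HasDerivAt (fun s => dt (Function.update d n s) x) (x n) s := by
      simp_rw [dt_update]
      simpa using (((hasDerivAt_id s).sub_const (d n)).mul_const (x n)).const_add (dt d x)
    have := (hasDerivAt_abs_cube (dt (Function.update d n s) x)).comp s h1
    exact this.congr_deriv (by unfold Ff; ring)

lemma deriv_sqrt_cube {N : ℕ} (d : Fin N → ℝ) (n : Fin N) (hn : d n ≠ 0) (A : Finset (Fin N)) :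
    HasDerivAt (fun s => √(∑ k ∈ A, Function.update d n s k ^ 2) ^ 3)
      (if n ∈ A then 3 * d n * √(∑ k ∈ A, d k ^ 2) else 0) (d n) := by
  by_cases hA : n ∈ A
  · rw [if_pos hA]
    have e : ∀ s, ∑ k ∈ A, Function.update d n s k ^ 2 = ∑ k ∈ A.erase n, d k ^ 2 + s ^ 2 := by
      intro s
      rw [← Finset.sum_erase_add _ _ hA, Function.update_self]
      congr 1
      exact Finset.sum_congr rfl fun k hk => by rw [Function.update_of_ne (Finset.ne_of_mem_erase hk)]
    have e0 : ∑ k ∈ A, d k ^ 2 = ∑ k ∈ A.erase n, d k ^ 2 + d n ^ 2 := 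
      (Finset.sum_erase_add _ _ hA).symm
    simp_rw [e]
    rw [e0]
    have hp : 0 < ∑ k ∈ A.erase n, d k ^ 2 + d n ^ 2 := by
      have : 0 ≤ ∑ k ∈ A.erase n, d k ^ 2 := Finset.sum_nonneg fun _ _ => sq_nonneg _
      positivity
    have h := (((hasDerivAt_pow 2 (d n)).const_add (∑ k ∈ A.erase n, d k ^ 2)).sqrt hp.ne').pow 3
    refine h.congr_deriv ?_
    have : √(∑ k ∈ A.erase n, d k ^ 2 + d n ^ 2) ≠ 0 := (Real.sqrt_pos.mpr hp).ne'
    field_simp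
    push_cast; ring
  · rw [if_neg hA]
    have e : ∀ s, ∑ k ∈ A, Function.update d n s k ^ 2 = ∑ k ∈ A, d k ^ 2 := fun s =>
      Finset.sum_congr rfl fun k hk => by
        rw [Function.update_of_ne (by rintro rfl; exact hA hk)]
    simp_rw [e]
    exact hasDerivAt_const _ _

lemma integral_Ff {θ : ℝ} (h0 : 0 ≤ θ) (h1 : θ ≤ 1) {N : ℕ} (d : Fin N → ℝ) (n : Fin N)
    (hn : d n ≠ 0) : (∫ x, Ff d n x ∂(bgPi θ N)) / d n
      = gammaThree * ∑ A : Finset (Fin N), pw θ N A * (if n ∈ A then √(∑ k ∈ A, d k ^ 2) else 0) := by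
  have H1 := deriv_cube (θ := θ) N d n
  simp_rw [integral_cube h0 h1] at H1
  have H2 := HasDerivAt.fun_sum (u := (Finset.univ : Finset (Finset (Fin N)))) fun A _ =>
    ((deriv_sqrt_cube d n hn A).const_mul gammaThree).const_mul (pw θ N A)
  have := H1.unique H2
  rw [integral_const_mul] at this
  have h3 : ∫ x, Ff d n x ∂(bgPi θ N) = (1/3) * (∑ A : Finset (Fin N), pw θ N A *
    (gammaThree * (if n ∈ A then 3 * d n * √(∑ k ∈ A, d k ^ 2) else 0))) := by rw [← this]; ring
  rw [h3, Finset.mul_sum, Finset.mul_sum, Finset.sum_div]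
  refine Finset.sum_congr rfl fun A _ => ?_
  split_ifs
  · field_simp
  · simp


lemma sum_split {N : ℕ} (n n' : Fin N) (hne : n' ≠ n) (f : Finset (Fin N) → ℝ) :
    ∑ A : Finset (Fin N), f A = ∑ A ∈ ((Finset.univ.erase n).erase n').powerset,
      (f A + f (insert n' A) + (f (insert n A) + f (insert n (insert n' A)))) := by
  set T := (Finset.univ.erase n).erase n' with hT
  have hn' : n' ∉ T := by simp [hT]
  have hn : n ∉ insert n' T := by simp [hT, hne.symm]
  have hu : insert n (insert n' T) = (Finset.univ : Finset (Fin N)) := by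
    rw [hT, Finset.insert_erase (by simp [hne]), Finset.insert_erase (by simp)]
  rw [← Finset.powerset_univ, ← hu, Finset.sum_powerset_insert hn, Finset.sum_powerset_insert hn',
    Finset.sum_powerset_insert hn', ← Finset.sum_add_distrib, ← Finset.sum_add_distrib,
    ← Finset.sum_add_distrib]

lemma sqrt_diff {a b S m : ℝ} (hS : 0 ≤ S) (hb : 0 ≤ b) (hm : m ≤ a - b) (hab : b ≤ a)
    (h1 : a + S ≤ 1) : m / 2 ≤ √(a + S) - √(b + S) := by
  have h2 : √(a + S) ≤ 1 := Real.sqrt_le_iff.mpr ⟨zero_le_one, by simpa using h1⟩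
  have h3 : √(b + S) ≤ √(a + S) := Real.sqrt_le_sqrt (by linarith)
  have h4 := Real.sq_sqrt (show 0 ≤ a + S by linarith)
  have h5 := Real.sq_sqrt (show 0 ≤ b + S by linarith)
  nlinarith

lemma pop_bound {θ : ℝ} (h0 : 0 ≤ θ) (h1 : θ ≤ 1) {N : ℕ} {ζ s : ℝ} (hζ : 0 < ζ) (d : Fin N → ℝ)
    (n n' : Fin N) (hne : n' ≠ n) (hd : goodSet N ζ n s d) (hn' : d n' ≠ 0) :
    gammaThree / (2 * N) * (θ * (1 - θ)) * (ζ / (1 + ζ)) ≤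
    (∫ x, Ff d n x ∂(bgPi θ N)) / d n - (∫ x, Ff d n' x ∂(bgPi θ N)) / d n' := by
  obtain ⟨hs, hpos, hmax⟩ := hd
  have hn : d n ≠ 0 := by rintro h; simp [h] at hpos
  have hNpos : 0 < (N : ℝ) := by
    have := n.pos
    exact_mod_cast this
  rw [integral_Ff h0 h1 d n hn, integral_Ff h0 h1 d n' hn', ← mul_sub, ← Finset.sum_sub_distrib,
    sum_split n n' hne]
  set T := (Finset.univ.erase n).erase n' with hT
  have hTcard : T.card + 2 = N := by
    have e1 : (Finset.univ.erase n).card + 1 = N := by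
      rw [Finset.card_erase_add_one (Finset.mem_univ _)]; simp
    have e2 : T.card + 1 = (Finset.univ.erase n).card :=
      Finset.card_erase_add_one (by simp [hne])
    omega
  have hdn : 1 / (N:ℝ) ≤ d n ^ 2 := by
    rw [div_le_iff₀ hNpos, ← hs]
    calc ∑ i, d i ^ 2 ≤ ∑ i : Fin N, d n ^ 2 := by
          refine Finset.sum_le_sum fun i _ => ?_
          by_cases hi : i = n
          · rw [hi]
          · have := hmax i hi; nlinarith [sq_nonneg (d i)]
      _ = _ := by simp; ring
  set m := ζ / (1 + ζ) / N with hm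
  have hmd : m ≤ d n ^ 2 - d n' ^ 2 := by
    have h2 := hmax n' hne
    have h3 : d n' ^ 2 ≤ d n ^ 2 / (1 + ζ) := by
      rw [le_div_iff₀ (by linarith)]; linarith
    have h4 : d n ^ 2 - d n ^ 2 / (1 + ζ) = ζ / (1 + ζ) * d n ^ 2 := by field_simp; ring
    have h5 : m ≤ ζ / (1 + ζ) * d n ^ 2 := by
      rw [hm, div_eq_mul_one_div (ζ / (1 + ζ))]
      gcongr
    linarith
  have hm0 : 0 ≤ m := by positivity
  have hg : 0 ≤ gammaThree := by unfold gammaThree; positivity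
  have h1θ : 0 ≤ 1 - θ := by linarith
  have hterm : ∀ A ∈ T.powerset, θ * (1 - θ) * (m / 2) * (θ ^ A.card * (1 - θ) ^ (T.card - A.card)) ≤
      (pw θ N A * (if n ∈ A then √(∑ k ∈ A, d k ^ 2) else 0)
        - pw θ N A * (if n' ∈ A then √(∑ k ∈ A, d k ^ 2) else 0)) +
      (pw θ N (insert n' A) * (if n ∈ insert n' A then √(∑ k ∈ insert n' A, d k ^ 2) else 0)
        - pw θ N (insert n' A) * (if n' ∈ insert n' A then √(∑ k ∈ insert n' A, d k ^ 2) else 0)) +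
      ((pw θ N (insert n A) * (if n ∈ insert n A then √(∑ k ∈ insert n A, d k ^ 2) else 0)
        - pw θ N (insert n A) * (if n' ∈ insert n A then √(∑ k ∈ insert n A, d k ^ 2) else 0)) +
      (pw θ N (insert n (insert n' A)) *
          (if n ∈ insert n (insert n' A) then √(∑ k ∈ insert n (insert n' A), d k ^ 2) else 0)
        - pw θ N (insert n (insert n' A)) *
          (if n' ∈ insert n (insert n' A) then √(∑ k ∈ insert n (insert n' A), d k ^ 2) else 0))) := by
    intro A hA
    have hAT := Finset.mem_powerset.mp hA
    have hnA : n ∉ A := fun h => by have := hAT h; simp [hT] at this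
    have hn'A : n' ∉ A := fun h => by have := hAT h; simp [hT] at this
    have hc := Finset.card_le_card hAT
    have hp1 : pw θ N (insert n A) = θ * (1 - θ) * (θ ^ A.card * (1 - θ) ^ (T.card - A.card)) := by
      rw [pw, Finset.card_insert_of_notMem hnA, show N - (A.card + 1) = (T.card - A.card) + 1 by omega]
      ring
    have hp2 : pw θ N (insert n' A) = θ * (1 - θ) * (θ ^ A.card * (1 - θ) ^ (T.card - A.card)) := by
      rw [pw, Finset.card_insert_of_notMem hn'A, show N - (A.card + 1) = (T.card - A.card) + 1 by omega]
      ring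
    simp only [hnA, hn'A, hne, hne.symm, Finset.mem_insert, if_true, if_false, or_false, true_or,
      or_true, mul_zero, sub_zero, sub_self, zero_add, add_zero, zero_sub]
    rw [hp1, hp2, Finset.sum_insert hnA, Finset.sum_insert hn'A]
    have hk := sqrt_diff (a := d n ^ 2) (b := d n' ^ 2) (S := ∑ k ∈ A, d k ^ 2) (m := m)
      (Finset.sum_nonneg fun _ _ => sq_nonneg _) (sq_nonneg _) hmd (by linarith) (by
        rw [← Finset.sum_insert (f := fun k => d k ^ 2) hnA, ← hs]
        exact Finset.sum_le_sum_of_subset_of_nonneg (Finset.subset_univ _)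
          fun _ _ _ => sq_nonneg _)
    have hw : 0 ≤ θ * (1 - θ) * (θ ^ A.card * (1 - θ) ^ (T.card - A.card)) := by positivity
    have := mul_le_mul_of_nonneg_left hk hw
    linarith
  have hsum := Finset.sum_le_sum hterm
  rw [← Finset.mul_sum, Finset.sum_pow_mul_eq_add_pow] at hsum
  have e : (θ + (1 - θ)) ^ T.card = 1 := by simp
  rw [e, mul_one] at hsum
  calc gammaThree / (2 * N) * (θ * (1 - θ)) * (ζ / (1 + ζ))
      = gammaThree * (θ * (1 - θ) * (m / 2)) := by rw [hm]; field_simp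
    _ ≤ _ := mul_le_mul_of_nonneg_left hsum hg


lemma chernoff {Ω : Type*} [MeasurableSpace Ω] (μ : Measure Ω) [IsProbabilityMeasure μ] (L : ℕ)
    (f : Ω → ℝ) (hf : Measurable f) {R v τ : ℝ} (hR : ∀ x, |f x| ≤ R) (hv : 0 < v)
    (hf2 : ∫ x, f x ^ 2 ∂μ ≤ v) (hτ : 0 < τ) (hτR : τ * R ≤ 2 * v) :
    (Measure.pi fun _ : Fin L => μ).real {ω | L * (∫ x, f x ∂μ + τ) ≤ ∑ i, f (ω i)}
      ≤ exp (-(L * τ ^ 2 / (4 * v))) := by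
  set l := τ / (2 * v) with hl
  have hl0 : 0 < l := by positivity
  have hlf : ∀ x, |l * f x| ≤ 1 := by
    intro x
    rw [abs_mul, abs_of_pos hl0, hl, div_mul_eq_mul_div, div_le_one (by positivity)]
    exact (mul_le_mul_of_nonneg_left (hR x) hτ.le).trans hτR
  have ib : ∀ g : Ω → ℝ, Measurable g → (∃ C, ∀ x, |g x| ≤ C) → Integrable g μ := by
    rintro g hg ⟨C, hC⟩
    exact Integrable.of_bound hg.aestronglyMeasurable C (.of_forall hC)
  have if1 : Integrable f μ := ib f hf ⟨R, hR⟩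
  have if2 : Integrable (fun x => f x ^ 2) μ := ib _ (by fun_prop) ⟨R ^ 2, fun x => by
    rw [abs_pow]; exact pow_le_pow_left₀ (abs_nonneg _) (hR x) 2⟩
  have ie : Integrable (fun x => exp (l * f x)) μ := ib _ (by fun_prop) ⟨exp 1, fun x => by
    rw [abs_of_pos (exp_pos _)]; exact exp_le_exp.mpr ((le_abs_self _).trans (hlf x))⟩
  set m := ∫ x, f x ∂μ with hm
  have hmgf : ∫ x, exp (l * f x) ∂μ ≤ exp (l * m + l ^ 2 * v) := by
    have h1 : ∫ x, exp (l * f x) ∂μ ≤ ∫ x, (1 + l * f x + l ^ 2 * f x ^ 2) ∂μ := by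
      refine integral_mono ie (((integrable_const _).add (if1.const_mul l)).add (if2.const_mul _)) ?_
      intro x
      have := (abs_le.mp (Real.abs_exp_sub_one_sub_id_le (hlf x))).2
      simp only
      nlinarith
    have ia : Integrable (fun x => 1 + l * f x) μ := (integrable_const _).add (if1.const_mul l)
    rw [integral_add ia (if2.const_mul _),
      integral_add (integrable_const _) (if1.const_mul l), integral_const_mul, integral_const_mul] at h1
    simp only [integral_const, probReal_univ, smul_eq_mul, mul_one] at h1
    have h2 := Real.add_one_le_exp (l * m + l ^ 2 * v)
    have h3 := mul_le_mul_of_nonneg_left hf2 (sq_nonneg l)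
    linarith
  have e : (fun ω : Fin L → Ω => exp (l * ∑ i, f (ω i))) = fun ω => ∏ i, exp (l * f (ω i)) := by
    ext ω; rw [← exp_sum, Finset.mul_sum]
  have hi : Integrable (fun ω : Fin L → Ω => exp (l * ∑ i, f (ω i)))
      (Measure.pi fun _ : Fin L => μ) := by
    rw [e]
    exact Integrable.fintype_prod (f := fun (_ : Fin L) x => exp (l * f x)) fun _ => ie
  have key := measure_ge_le_exp_mul_mgf (μ := Measure.pi fun _ : Fin L => μ)
    (X := fun ω => ∑ i, f (ω i)) (L * (m + τ)) hl0.le hi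
  refine key.trans ?_
  rw [mgf, e, integral_fintype_prod_eq_pow (f := fun x => exp (l * f x)), Fintype.card_fin]
  calc exp (-l * (L * (m + τ))) * (∫ x, exp (l * f x) ∂μ) ^ L
      ≤ exp (-l * (L * (m + τ))) * (exp (l * m + l ^ 2 * v)) ^ L := by
        gcongr
    _ = exp (-(L * τ ^ 2 / (4 * v))) := by
        rw [← exp_nat_mul, ← exp_add]
        congr 1
        rw [hl]; field_simp; ring

/-- truncated summand -/
noncomputable def Ft {N : ℕ} (t : ℝ) (d : Fin N → ℝ) (n : Fin N) : (Fin N → ℝ) → ℝ :=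
  Set.indicator {x | qn x ≤ t} (Ff d n)

lemma meas_ball {N : ℕ} (t : ℝ) : MeasurableSet {x : Fin N → ℝ | qn x ≤ t} :=
  measurableSet_le (by fun_prop) (by fun_prop)

lemma Ft_meas {N : ℕ} (t : ℝ) (d : Fin N → ℝ) (n : Fin N) : Measurable (Ft t d n) :=
  (continuous_Ff d n).measurable.indicator (meas_ball t)

lemma Ft_abs_le {N : ℕ} (t : ℝ) (d : Fin N → ℝ) (hd : qn d ≤ 1) (n : Fin N) (x : Fin N → ℝ) :
    |Ft t d n x| ≤ √t ^ 3 := by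
  unfold Ft Set.indicator
  split_ifs with h
  · refine (Ff_abs_le d n x).trans ?_
    have : √(qn x) ≤ √t := Real.sqrt_le_sqrt h
    calc qn d * √(qn x) ^ 3 ≤ 1 * √t ^ 3 := by gcongr
      _ = _ := one_mul _
  · simp

lemma Ft_integrable {N : ℕ} (θ t : ℝ) (d : Fin N → ℝ) (n : Fin N) :
    Integrable (Ft t d n) (bgPi θ N) := (integrable_Ff θ d n).indicator (meas_ball t)

lemma Ft_second {N : ℕ} {θ : ℝ} (h0 : 0 ≤ θ) (h1 : θ ≤ 1) (t : ℝ) (d : Fin N → ℝ) (hd : qn d ≤ 1)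
    (n : Fin N) : ∫ x, Ft t d n x ^ 2 ∂(bgPi θ N) ≤ 5000 * θ := by
  obtain ⟨i, b⟩ := second_moment h0 h1 d hd n
  refine (integral_mono_of_nonneg (.of_forall fun x => sq_nonneg _) i (.of_forall fun x => ?_)).trans b
  simp only [Ft, Set.indicator]
  split_ifs
  · exact le_rfl
  · rw [zero_pow two_ne_zero]; exact sq_nonneg _

lemma bias {N : ℕ} {θ : ℝ} (h0 : 0 ≤ θ) (h1 : θ ≤ 1) (t : ℝ) (d : Fin N → ℝ) (hd : qn d ≤ 1)
    (n : Fin N) : |∫ x, Ff d n x ∂(bgPi θ N) - ∫ x, Ft t d n x ∂(bgPi θ N)|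
      ≤ 128 * exp (N * θ - t / 4) := by
  rw [← integral_sub (integrable_Ff θ d n) (Ft_integrable θ t d n)]
  refine (abs_integral_le_integral_abs).trans ?_
  have hb : ∀ x, |Ff d n x - Ft t d n x| ≤ 128 * exp (-(t / 4)) * exp (3 / 8 * qn x) := by
    intro x
    unfold Ft Set.indicator
    split_ifs with h
    · simp; positivity
    · rw [sub_zero]
      simp only [Set.mem_ofPred_eq, not_le] at h
      calc |Ff d n x| ≤ qn d * √(qn x) ^ 3 := Ff_abs_le d n x
        _ ≤ 1 * (128 * exp (qn x / 8)) := by gcongr; exact sqrt_cube_le (qn_nonneg x)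
        _ ≤ 128 * exp (-(t / 4) + 3 / 8 * qn x) := by
          rw [one_mul]; gcongr; linarith
        _ = _ := by rw [exp_add]; ring
  refine (integral_mono ((integrable_Ff θ d n).sub (Ft_integrable θ t d n)).abs
    ((integrable_exp_qn θ N).const_mul _) hb).trans ?_
  rw [integral_const_mul]
  calc _ ≤ 128 * exp (-(t/4)) * exp (N * θ) := by gcongr; exact integral_exp_qn h0 h1 N
    _ = _ := by rw [mul_assoc, ← exp_add]; congr 2; ring

lemma tail {N : ℕ} {θ : ℝ} (h0 : 0 ≤ θ) (h1 : θ ≤ 1) (t : ℝ) :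
    (bgPi θ N).real {x | t < qn x} ≤ exp (N * θ - 3 / 8 * t) := by
  have := bgPi_isProb h0 h1 N
  have key := measure_ge_le_exp_mul_mgf (μ := bgPi θ N) (X := qn) t (t := 3 / 8) (by norm_num)
    (integrable_exp_qn θ N)
  refine (measureReal_mono (fun x (hx : t < qn x) => hx.le)).trans (key.trans ?_)
  calc _ ≤ exp (-(3/8) * t) * exp (N * θ) := by gcongr; exact integral_exp_qn h0 h1 N
    _ = _ := by rw [← exp_add]; congr 1; ring

lemma dt_sub {N : ℕ} (d d' x : Fin N → ℝ) : dt d x - dt d' x = dt (d - d') x := by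
  simp [dt, sub_mul]

lemma Ft_lip {N : ℕ} (t : ℝ) (d d' : Fin N → ℝ) (hd : qn d ≤ 1) (hd' : qn d' ≤ 1) {ε : ℝ}
    (he : √(qn (d - d')) ≤ ε) (n : Fin N) (x : Fin N → ℝ) :
    |Ft t d n x - Ft t d' n x| ≤ 2 * ε * √t ^ 3 := by
  have hε : 0 ≤ ε := (Real.sqrt_nonneg _).trans he
  unfold Ft Set.indicator
  split_ifs with h
  · have hq : √(qn x) ≤ √t := Real.sqrt_le_sqrt h
    have hz : ∀ e : Fin N → ℝ, qn e ≤ 1 → |dt e x| ≤ √t := by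
      intro e he
      refine (dt_abs_le e x).trans ?_
      have : √(qn e) ≤ 1 := Real.sqrt_le_iff.mpr ⟨zero_le_one, by simpa using he⟩
      calc √(qn e) * √(qn x) ≤ 1 * √t := by gcongr
        _ = _ := one_mul _
    have hdiff : |dt d x - dt d' x| ≤ ε * √t := by
      rw [dt_sub]
      exact (dt_abs_le _ x).trans (by gcongr)
    have h1 := hz d hd
    have h2 := hz d' hd'
    have h3 := (coord_abs_le x n).trans hq
    have h4 : |(dt d x * |dt d x| - dt d' x * |dt d' x|)| ≤ 2 * ε * √t ^ 2 := by
      have e : dt d x * |dt d x| - dt d' x * |dt d' x|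
        = (dt d x - dt d' x) * |dt d x| + dt d' x * (|dt d x| - |dt d' x|) := by ring
      rw [e]
      refine (abs_add_le _ _).trans ?_
      rw [abs_mul, abs_mul, abs_abs]
      have h5 := (abs_abs_sub_abs_le_abs_sub (dt d x) (dt d' x)).trans hdiff
      calc _ ≤ (ε * √t) * √t + √t * (ε * √t) := by gcongr
        _ = _ := by ring
    have : Ff d n x - Ff d' n x = (dt d x * |dt d x| - dt d' x * |dt d' x|) * x n := by
      unfold Ff; ring
    rw [this, abs_mul]
    calc _ ≤ 2 * ε * √t ^ 2 * √t := by gcongr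
      _ = _ := by ring
  · simp; positivity

lemma net (N M : ℕ) (hM : 0 < M) : ∃ S : Finset (Fin N → ℝ), S.card ≤ (2 * M + 1) ^ N ∧
    (∀ e ∈ S, qn e ≤ 1) ∧ ∀ d : Fin N → ℝ, qn d ≤ 1 → ∃ e ∈ S, √(qn (d - e)) ≤ N / M := by
  classical
  have hM' : (0:ℝ) < M := by exact_mod_cast hM
  set I : Finset ℝ := (Finset.Icc (-(M:ℤ)) M).image (fun j : ℤ => (j : ℝ) / M) with hI
  refine ⟨(Fintype.piFinset fun _ : Fin N => I).filter (fun e => qn e ≤ 1), ?_, ?_, ?_⟩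
  · refine (Finset.card_filter_le _ _).trans ?_
    rw [Fintype.card_piFinset, Finset.prod_const, Finset.card_univ, Fintype.card_fin]
    refine Nat.pow_le_pow_left (Finset.card_image_le.trans ?_) _
    rw [Int.card_Icc]; omega
  · intro e he; exact (Finset.mem_filter.mp he).2
  · intro d hd
    have h1 : ∀ k, |d k| ≤ 1 := fun k =>
      (coord_abs_le d k).trans (Real.sqrt_le_iff.mpr ⟨zero_le_one, by simpa using hd⟩)
    have hr : ∀ k, ∃ y ∈ I, |y| ≤ |d k| ∧ |d k - y| ≤ 1 / M := by
      intro k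
      have hk := abs_le.mp (h1 k)
      have hpos : ∀ a : ℝ, 0 ≤ a → a ≤ 1 → 0 ≤ ⌊M * a⌋ ∧ ⌊M * a⌋ ≤ M ∧ (⌊M * a⌋ : ℝ) / M ≤ a ∧
          a - (⌊M * a⌋ : ℝ) / M ≤ 1 / M := by
        intro a ha ha1
        have f1 := Int.floor_le (M * a)
        have f2 := Int.lt_floor_add_one (M * a)
        refine ⟨Int.floor_nonneg.mpr (by positivity), ?_, ?_, ?_⟩
        · have : (⌊M * a⌋ : ℝ) ≤ (M : ℤ) := by push_cast; nlinarith
          exact_mod_cast this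
        · rw [div_le_iff₀ hM']; linarith
        · rw [sub_le_iff_le_add, ← add_div, le_div_iff₀ hM']; linarith
      rcases le_total 0 (d k) with h | h
      · obtain ⟨a1, a2, a3, a4⟩ := hpos (d k) h hk.2
        have a5 : (0:ℝ) ≤ (⌊M * d k⌋ : ℝ) / M := by
          have : (0:ℝ) ≤ (⌊M * d k⌋ : ℝ) := by exact_mod_cast a1
          positivity
        refine ⟨(⌊M * d k⌋ : ℝ) / M, Finset.mem_image.mpr ⟨⌊M * d k⌋, ?_, rfl⟩, ?_, ?_⟩
        · rw [Finset.mem_Icc]; omega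
        · rw [abs_of_nonneg a5, abs_of_nonneg h]; exact a3
        · rw [abs_of_nonneg (by linarith)]; exact a4
      · obtain ⟨a1, a2, a3, a4⟩ := hpos (-d k) (by linarith) (by linarith)
        have a5 : (0:ℝ) ≤ (⌊M * -d k⌋ : ℝ) / M := by
          have : (0:ℝ) ≤ (⌊M * -d k⌋ : ℝ) := by exact_mod_cast a1
          positivity
        refine ⟨-((⌊M * -d k⌋ : ℝ) / M), Finset.mem_image.mpr ⟨-⌊M * -d k⌋, ?_, ?_⟩, ?_, ?_⟩
        · rw [Finset.mem_Icc]; omega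
        · push_cast; ring
        · rw [abs_neg, abs_of_nonneg a5, abs_of_nonpos h]; exact a3
        · rw [abs_of_nonpos (by linarith)]; linarith
    choose y hyI hy1 hy2 using hr
    refine ⟨y, Finset.mem_filter.mpr ⟨Fintype.mem_piFinset.mpr hyI, ?_⟩, ?_⟩
    · refine le_trans (Finset.sum_le_sum fun k _ => ?_) hd
      exact sq_le_sq.mpr (hy1 k)
    · rw [Real.sqrt_le_left (by positivity)]
      calc qn (d - y) ≤ ∑ k : Fin N, (1 / (M:ℝ)) ^ 2 := Finset.sum_le_sum fun k _ => by
            rw [← sq_abs, Pi.sub_apply]; exact pow_le_pow_left₀ (abs_nonneg _) (hy2 k) 2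
        _ = N * (1 / (M:ℝ)) ^ 2 := by simp
        _ ≤ (N / M) ^ 2 := by
          rw [div_pow, div_pow, one_pow, mul_one_div]
          have : (N:ℝ) ≤ N ^ 2 := by exact_mod_cast Nat.le_self_pow (by norm_num) N
          gcongr


/-- the good event -/
def goodEv (θ : ℝ) (N L : ℕ) (t τ : ℝ) (S : Finset (Fin N → ℝ)) : Set (Fin L → Fin N → ℝ) :=
  {ω | (∀ i, qn (ω i) ≤ t) ∧ ∀ n, ∀ e ∈ S,
    |∑ i, Ft t e n (ω i) - L * ∫ x, Ft t e n x ∂(bgPi θ N)| ≤ L * τ}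

lemma goodEv_prob {θ : ℝ} (h0 : 0 < θ) (h1 : θ ≤ 1) (N L : ℕ) {t τ : ℝ} (hτ : 0 < τ)
    (hτt : τ * √t ^ 3 ≤ 2 * (5000 * θ)) (S : Finset (Fin N → ℝ)) (hS : ∀ e ∈ S, qn e ≤ 1) :
    (bgSamples θ N L).real (goodEv θ N L t τ S)ᶜ ≤
      L * exp (N * θ - 3 / 8 * t) +
        N * (S.card * (2 * exp (-(L * τ ^ 2 / (4 * (5000 * θ)))))) := by
  have := bgPi_isProb h0.le h1 N
  have := bgSamples_isProb h0.le h1 N L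
  set U : Fin N → (Fin N → ℝ) → Set (Fin L → Fin N → ℝ) := fun n e =>
    {ω | L * (∫ x, Ft t e n x ∂(bgPi θ N) + τ) ≤ ∑ i, Ft t e n (ω i)} with hU
  set V : Fin N → (Fin N → ℝ) → Set (Fin L → Fin N → ℝ) := fun n e =>
    {ω | L * (∫ x, - Ft t e n x ∂(bgPi θ N) + τ) ≤ ∑ i, - Ft t e n (ω i)} with hV
  have hsub : (goodEv θ N L t τ S)ᶜ ⊆ (⋃ i : Fin L, {ω | t < qn (ω i)}) ∪
      ⋃ n : Fin N, ⋃ e ∈ S, (U n e ∪ V n e) := by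
    intro ω hω
    by_contra hc
    apply hω
    simp only [Set.mem_union, Set.mem_iUnion, not_or, not_exists] at hc
    obtain ⟨hc1, hc2⟩ := hc
    refine ⟨fun i => not_lt.mp (hc1 i), fun n e he => ?_⟩
    obtain ⟨hu, hv⟩ := hc2 n e he
    have hu' : ¬ (L * (∫ x, Ft t e n x ∂(bgPi θ N) + τ) ≤ ∑ i, Ft t e n (ω i)) := hu
    have hv' : ¬ (L * (∫ x, - Ft t e n x ∂(bgPi θ N) + τ) ≤ ∑ i, - Ft t e n (ω i)) := hv
    rw [integral_neg, Finset.sum_neg_distrib] at hv'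
    rw [abs_le]
    constructor <;> linarith
  refine (measureReal_mono hsub).trans ((measureReal_union_le _ _).trans (add_le_add ?_ ?_))
  · refine (measureReal_iUnion_fintype_le _).trans ?_
    refine (Finset.sum_le_card_nsmul _ _ (exp (N * θ - 3 / 8 * t)) fun i _ => ?_).trans ?_
    · have hmp := measurePreserving_eval (fun _ : Fin L => bgPi θ N) i
      have : (bgSamples θ N L).real {ω | t < qn (ω i)} = (bgPi θ N).real {x | t < qn x} := by
        unfold bgSamples
        exact hmp.measureReal_preimage (s := {x | t < qn x})
          (measurableSet_lt (by fun_prop) (by fun_prop)).nullMeasurableSet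
      rw [this]
      exact tail h0.le h1 t
    · simp
  · refine (measureReal_iUnion_fintype_le _).trans ?_
    refine (Finset.sum_le_card_nsmul _ _
      (S.card * (2 * exp (-(L * τ ^ 2 / (4 * (5000 * θ)))))) fun n _ => ?_).trans ?_
    · refine (measureReal_biUnion_finset_le _ _).trans ?_
      rw [← nsmul_eq_mul]
      refine Finset.sum_le_card_nsmul _ _ _ fun e he => ?_
      refine (measureReal_union_le _ _).trans ?_
      rw [two_mul]
      refine add_le_add ?_ ?_
      · exact chernoff (bgPi θ N) L (Ft t e n) (Ft_meas t e n) (Ft_abs_le t e (hS e he) n)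
          (by positivity) (Ft_second h0.le h1 t e (hS e he) n) hτ hτt
      · exact chernoff (bgPi θ N) L (fun x => - Ft t e n x) (Ft_meas t e n).neg
          (fun x => by rw [abs_neg]; exact Ft_abs_le t e (hS e he) n x)
          (by positivity) (by simpa using Ft_second h0.le h1 t e (hS e he) n) hτ hτt
    · simp

lemma uniform_dev {θ : ℝ} (h0 : 0 < θ) (h1 : θ ≤ 1) {N L : ℕ} {t τ ε : ℝ}
    (S : Finset (Fin N → ℝ)) (hS : ∀ e ∈ S, qn e ≤ 1)
    (hnet : ∀ d : Fin N → ℝ, qn d ≤ 1 → ∃ e ∈ S, √(qn (d - e)) ≤ ε)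
    (ω : Fin L → Fin N → ℝ) (hω : ω ∈ goodEv θ N L t τ S) (d : Fin N → ℝ) (hd : qn d ≤ 1)
    (n : Fin N) :
    |∑ i, Ff d n (ω i) - L * ∫ x, Ff d n x ∂(bgPi θ N)| ≤
      L * (τ + 2 * (2 * ε * √t ^ 3) + 128 * exp (N * θ - t / 4)) := by
  have := bgPi_isProb h0.le h1 N
  obtain ⟨hq, hdev⟩ := hω
  obtain ⟨e, heS, he⟩ := hnet d hd
  have e1 : ∑ i, Ff d n (ω i) = ∑ i, Ft t d n (ω i) :=
    Finset.sum_congr rfl fun i _ => (Set.indicator_of_mem (s := {x | qn x ≤ t}) (hq i) _).symm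
  have b1 : |∑ i, Ft t d n (ω i) - ∑ i, Ft t e n (ω i)| ≤ L * (2 * ε * √t ^ 3) := by
    rw [← Finset.sum_sub_distrib]
    refine (Finset.abs_sum_le_sum_abs _ _).trans ?_
    refine (Finset.sum_le_card_nsmul _ _ _ fun i _ => Ft_lip t d e hd (hS e heS) he n (ω i)).trans ?_
    simp
  have b2 : |∫ x, Ft t d n x ∂(bgPi θ N) - ∫ x, Ft t e n x ∂(bgPi θ N)| ≤ 2 * ε * √t ^ 3 := by
    rw [← integral_sub (Ft_integrable θ t d n) (Ft_integrable θ t e n)]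
    have := norm_integral_le_of_norm_le_const (μ := bgPi θ N)
      (f := fun x => Ft t d n x - Ft t e n x) (C := 2 * ε * √t ^ 3)
      (.of_forall fun x => Ft_lip t d e hd (hS e heS) he n x)
    simpa using this
  have b3 := bias h0.le h1 t d hd n
  have b4 := hdev n e heS
  have hL : (0:ℝ) ≤ L := Nat.cast_nonneg _
  rw [e1]
  rw [abs_le] at *
  have m1 := mul_le_mul_of_nonneg_left b2.1 hL
  have m2 := mul_le_mul_of_nonneg_left b2.2 hL
  have m3 := mul_le_mul_of_nonneg_left b3.1 hL
  have m4 := mul_le_mul_of_nonneg_left b3.2 hL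
  constructor <;> nlinarith

lemma inv_norm_bound (p q : ℝ) : 3 / 5 * (|p| + |q|) ≤ √(p ^ 2 + q ^ 2) := by
  apply Real.le_sqrt_of_sq_le
  rw [← sq_abs p, ← sq_abs q]
  nlinarith [sq_nonneg (|p| - |q|), sq_nonneg (|p| + |q|)]

lemma final_ineq {θ : ℝ} (h0 : 0 < θ) (h1 : θ ≤ 1) {N L : ℕ} (hL : 0 < L) {ζ s δ : ℝ} (hζ : 0 < ζ)
    (hδ : 0 < δ) (ω : Fin L → Fin N → ℝ)
    (hdev : ∀ d : Fin N → ℝ, qn d ≤ 1 → ∀ n,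
      |∑ i, Ff d n (ω i) - L * ∫ x, Ff d n x ∂(bgPi θ N)| ≤ L * (δ / 5))
    (n n' : Fin N) (d : Fin N → ℝ) (hd : goodSet N ζ n s d) (hne : n' ≠ n) (hn' : d n' ≠ 0) :
    empNegRGrad N L ω d n / d n - empNegRGrad N L ω d n' / d n' ≥
      3 * gammaThree / (2 * N) * (θ * (1 - θ)) * (ζ / (1 + ζ)) -
        δ * Real.sqrt ((1 / d n') ^ 2 + (1 / d n) ^ 2) := by
  have hL' : (0:ℝ) < L := by exact_mod_cast hL
  have hn : d n ≠ 0 := by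
    rintro h
    have := hd.2.1
    simp [h] at this
  have hpop := pop_bound h0.le h1 hζ d n n' hne hd hn'
  have hG : ∀ j, empG N L ω d j = 3 / L * ∑ i, Ff d j (ω i) := fun j => rfl
  have hdiv : ∀ j, |empG N L ω d j / d j - 3 * ((∫ x, Ff d j x ∂(bgPi θ N)) / d j)|
      ≤ 3 / 5 * δ * |1 / d j| := by
    intro j
    have := hdev d hd.1.le j
    have e : empG N L ω d j / d j - 3 * ((∫ x, Ff d j x ∂(bgPi θ N)) / d j)
      = (3 / L * (∑ i, Ff d j (ω i) - L * ∫ x, Ff d j x ∂(bgPi θ N))) * (1 / d j) := by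
      rw [hG]; field_simp
    rw [e, abs_mul]
    gcongr
    rw [abs_mul, abs_of_pos (by positivity)]
    calc 3 / (L:ℝ) * _ ≤ 3 / (L:ℝ) * (L * (δ / 5)) := by gcongr
      _ = 3 / 5 * δ := by field_simp
  have a1 := abs_le.mp (hdiv n)
  have a2 := abs_le.mp (hdiv n')
  have a3 := mul_le_mul_of_nonneg_left (inv_norm_bound (1 / d n') (1 / d n)) hδ.le
  have e1 : empNegRGrad N L ω d n / d n - empNegRGrad N L ω d n' / d n'
      = empG N L ω d n / d n - empG N L ω d n' / d n' := by
    unfold empNegRGrad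
    field_simp
    ring
  rw [e1]
  have e2 : 3 * gammaThree / (2 * N) * (θ * (1 - θ)) * (ζ / (1 + ζ))
    = 3 * (gammaThree / (2 * N) * (θ * (1 - θ)) * (ζ / (1 + ζ))) := by ring
  rw [e2]
  linarith [a1.1, a2.2]


lemma params {N L : ℕ} {θ δ : ℝ} (hθ1 : 1 / (N : ℝ) < θ) (hθ2 : θ < 1 / 2) (hδ0 : 0 < δ)
    (hδ : δ < (1 / 10000) / ((N : ℝ) * Real.log L * Real.log (N * L) * θ ^ ((1 : ℝ) / 3))
              ^ ((3 : ℝ) / 2)) :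
    3 ≤ N ∧ 2 ≤ L ∧ δ * N ≤ 1 / 10000 ∧ δ * √(N * θ * Real.log L) ^ 3 ≤ 1 / 10000 * θ := by
  have hN0 : N ≠ 0 := by
    rintro rfl
    norm_num at hδ
    linarith
  have hN0' : (0:ℝ) < N := by exact_mod_cast Nat.pos_of_ne_zero hN0
  have hN : 3 ≤ N := by
    by_contra h
    have : (N:ℝ) ≤ 2 := by exact_mod_cast (by omega : N ≤ 2)
    have : 1 / 2 ≤ 1 / (N:ℝ) := by gcongr
    linarith
  have hL : 2 ≤ L := by
    by_contra h
    have : L = 0 ∨ L = 1 := by omega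
    rcases this with rfl | rfl <;> norm_num at hδ <;> linarith
  have hθ : 0 < θ := lt_trans (by positivity) hθ1
  have hNθ : 1 < N * θ := by
    rw [div_lt_iff₀ hN0'] at hθ1; linarith
  have hl2 := Real.log_two_gt_d9
  have hLr : (2:ℝ) ≤ L := by exact_mod_cast hL
  have hNr : (3:ℝ) ≤ N := by exact_mod_cast hN
  have hlL : Real.log 2 ≤ Real.log L := Real.log_le_log (by norm_num) hLr
  have hl6 : 1.7 ≤ Real.log (N * L) := by
    have a : Real.log 6 ≤ Real.log (N * L) := Real.log_le_log (by norm_num) (by nlinarith)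
    have b : Real.log 32 ≤ Real.log 36 := Real.log_le_log (by norm_num) (by norm_num)
    rw [show (32:ℝ) = 2 ^ 5 by norm_num, show (36:ℝ) = 6 ^ 2 by norm_num, Real.log_pow, Real.log_pow] at b
    push_cast at b
    linarith
  set lL := Real.log L
  set lN := Real.log (N * L)
  set r := θ ^ ((1:ℝ)/3) with hr
  have hr0 : 0 < r := by positivity
  have hr3 : r ^ 3 = θ := by
    rw [hr, ← Real.rpow_natCast, ← Real.rpow_mul hθ.le]; norm_num
  have hprod : 1 ≤ lL * lN := by nlinarith
  set D := (N : ℝ) * lL * lN * r with hD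
  have hDge : N * r ≤ D := by
    have : 0 ≤ N * r := by positivity
    rw [hD]; nlinarith
  have hD0 : 0 < D := lt_of_lt_of_le (by positivity) hDge
  have hW : D ^ ((3:ℝ)/2) = √D ^ 3 := by
    rw [Real.sqrt_eq_rpow, ← Real.rpow_natCast, ← Real.rpow_mul hD0.le]; norm_num
  rw [hW, lt_div_iff₀ (by positivity)] at hδ
  have hsq : ∀ y : ℝ, 0 ≤ y → √y ^ 3 = √(y ^ 3) := by
    intro y hy
    rw [eq_comm, Real.sqrt_eq_iff_mul_self_eq (by positivity) (by positivity)]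
    rw [← pow_add, show 3 + 3 = 2 * 3 from rfl, pow_mul, Real.sq_sqrt hy]
  refine ⟨hN, hL, ?_, ?_⟩
  · have : (N:ℝ) ≤ √D ^ 3 := by
      rw [hsq D hD0.le]
      apply Real.le_sqrt_of_sq_le
      calc (N:ℝ) ^ 2 ≤ N ^ 2 * (N * θ) := by nlinarith [sq_nonneg (N:ℝ)]
        _ = (N * r) ^ 3 := by rw [mul_pow, hr3]; ring
        _ ≤ D ^ 3 := by gcongr
    nlinarith
  · have hlp : 0 ≤ lL := by linarith
    have : √(N * θ * lL) ^ 3 ≤ θ * √D ^ 3 := by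
      rw [hsq _ (by positivity), hsq D hD0.le]
      rw [show θ * √(D ^ 3) = √(θ ^ 2 * D ^ 3) by
        rw [Real.sqrt_mul (by positivity), Real.sqrt_sq hθ.le]]
      apply Real.sqrt_le_sqrt
      have hk : N * θ * lL ≤ r ^ 2 * D := by
        have e : N * θ * lL = N * lL * r ^ 3 := by rw [hr3]; ring
        rw [e, hD]
        have : 0 ≤ N * lL * r ^ 3 := by positivity
        nlinarith
      calc (N * θ * lL) ^ 3 ≤ (r ^ 2 * D) ^ 3 := by gcongr
        _ = (r ^ 3) ^ 2 * D ^ 3 := by ring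
        _ = _ := by rw [hr3]
    nlinarith

lemma count_bound {N L : ℕ} {θ δ : ℝ} {K : ℝ} (hN : 3 ≤ N) (hθ : 0 < θ) (hθ2 : θ < 1 / 2)
    (hδ0 : 0 < δ) (hNδ : δ * N ≤ 1 / 10000) (hL : 0 < L)
    (hA : 10 ^ 15 * (N * Real.log (1 / δ)) ≤ L * δ ^ 2 / θ)
    (hl : 1 ≤ Real.log (1 / δ)) (hK : K ≤ (δ⁻¹ ^ 3) ^ N) (hK0 : 0 ≤ K) :
    N * (K * (2 * exp (-(L * (δ / 20) ^ 2 / (4 * (5000 * θ)))))) ≤ 1 / (2 * L) := by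
  have hL' : (0:ℝ) < L := by exact_mod_cast hL
  have hNr : (3:ℝ) ≤ N := by exact_mod_cast hN
  set A := L * δ ^ 2 / θ with hAd
  set l := Real.log (1 / δ) with hld
  have hexpl : exp l = δ⁻¹ := by rw [hld, Real.exp_log (by positivity)]; simp
  have e1 : L * (δ / 20) ^ 2 / (4 * (5000 * θ)) = A / 8000000 := by
    rw [hAd]; field_simp; norm_num
  rw [e1]
  have hLA : (L:ℝ) ≤ A * exp (2 * l) := by
    have : exp (2 * l) = δ⁻¹ ^ 2 := by rw [← hexpl, ← exp_nat_mul]; norm_num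
    rw [this, hAd]
    have : (L:ℝ) * δ ^ 2 / θ * δ⁻¹ ^ 2 = L / θ := by field_simp
    rw [this, le_div_iff₀ hθ]
    nlinarith
  have hNl : 4 * (N:ℝ) ≤ exp l := by
    rw [hexpl, ← one_div, le_div_iff₀ hδ0]; nlinarith
  have hKl : K ≤ exp (3 * N * l) := by
    refine hK.trans (le_of_eq ?_)
    rw [← hexpl, ← exp_nat_mul, ← exp_nat_mul]; congr 1; push_cast; ring
  have hN1 : (3:ℝ) ≤ N * l := by nlinarith
  have hAbig : 3 * 10 ^ 15 ≤ A := by linarith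
  have hAe : A ≤ exp (A / 16000000) := by
    have := Real.quadratic_le_exp_of_nonneg (show 0 ≤ A / 16000000 by positivity)
    nlinarith
  rw [le_div_iff₀ (by positivity)]
  calc N * (K * (2 * exp (-(A / 8000000)))) * (2 * L)
      = (4 * N) * K * L * exp (-(A / 8000000)) := by ring
    _ ≤ exp l * exp (3 * N * l) * (exp (A / 16000000) * exp (2 * l)) * exp (-(A / 8000000)) := by
        gcongr
        exact hLA.trans (by gcongr)
    _ = exp (l + 3 * N * l + (A / 16000000 + 2 * l) + -(A / 8000000)) := by
        rw [← exp_add, ← exp_add, ← exp_add, ← exp_add]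
    _ ≤ 1 := by
        rw [Real.exp_le_one_iff]
        have : 3 * l ≤ N * l := by nlinarith
        linarith

set_option maxHeartbeats 4000000 in
/-- benign global geometry of the empirical problem: there are absolute
constants c₁, C₁ > 0 such that for θ ∈ (1/N, 1/2), ζ₀ ∈ (0,1),
δ ∈ (0, c₁/(N log L log(NL) θ^{1/3})^{3/2}) and L ≥ C₁ δ⁻² N θ log(Nθ/δ), with
probability ≥ 1 − 1/L, simultaneously for all 2N good subsets S_{ζ₀}^{(n±)}:
for all d ∈ S_{ζ₀}^{(n±)} and all n' ≠ n with d_{n'} ≠ 0,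
⟨−(I−ddᵀ)∇f(d), (1/d_n)e_n − (1/d_{n'})e_{n'}⟩ ≥
  (3γ₃/(2N))θ(1−θ)ζ₀/(1+ζ₀) − δ‖(1/d_{n'})e_{n'} − (1/d_n)e_n‖. -/
theorem stmt11 :
    ∃ c₁ > (0 : ℝ), ∃ C₁ > (0 : ℝ),
      ∀ (N L : ℕ) (θ ζ₀ δ : ℝ),
        1 / (N : ℝ) < θ → θ < 1 / 2 →
        ζ₀ ∈ Set.Ioo (0 : ℝ) 1 →
        0 < δ →
        δ < c₁ / ((N : ℝ) * Real.log L * Real.log (N * L) * θ ^ ((1 : ℝ) / 3))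
              ^ ((3 : ℝ) / 2) →
        (L : ℝ) ≥ C₁ * δ⁻¹ ^ 2 * N * θ * Real.log ((N : ℝ) * θ / δ) →
        bgSamples θ N L
            {ω | ∀ (n : Fin N) (s : ℝ), (s = 1 ∨ s = -1) →
              ∀ d : Fin N → ℝ, goodSet N ζ₀ n s d →
              ∀ n' ≠ n, d n' ≠ 0 →
              empNegRGrad N L ω d n / d n - empNegRGrad N L ω d n' / d n' ≥
                3 * gammaThree / (2 * N) * (θ * (1 - θ)) * (ζ₀ / (1 + ζ₀)) -
                  δ * Real.sqrt ((1 / d n') ^ 2 + (1 / d n) ^ 2)} ≥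
          ENNReal.ofReal (1 - 1 / (L : ℝ)) := by

  refine ⟨1 / 10000, by norm_num, 10 ^ 15, by norm_num, ?_⟩
  intro N L θ ζ₀ δ hθ1 hθ2 hζ hδ0 hδ hLδ
  obtain ⟨hN, hL, hNδ, hX⟩ := params hθ1 hθ2 hδ0 hδ
  have hNr : (3:ℝ) ≤ N := by exact_mod_cast hN
  have hLr : (2:ℝ) ≤ L := by exact_mod_cast hL
  have hN0 : (0:ℝ) < N := by linarith
  have hL0 : (0:ℝ) < L := by linarith
  have hθ : 0 < θ := lt_trans (by positivity) hθ1
  have hθ1' : θ ≤ 1 := by linarith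
  have hNθ : 1 < N * θ := by
    rw [div_lt_iff₀ hN0] at hθ1; linarith
  have hδs : δ ≤ 1 / 30000 := by nlinarith
  have hl : 1 ≤ Real.log (1 / δ) := by
    rw [Real.le_log_iff_exp_le (by positivity), le_div_iff₀ hδ0]
    have := Real.exp_one_lt_d9
    nlinarith
  have hll : Real.log (1 / δ) ≤ Real.log (N * θ / δ) :=
    Real.log_le_log (by positivity) (by gcongr)
  have hLl : 10 ^ 15 * δ⁻¹ ^ 2 * N * θ * Real.log (1 / δ) ≤ L := le_trans (by gcongr) hLδ
  have hA : 10 ^ 15 * (N * Real.log (1 / δ)) ≤ L * δ ^ 2 / θ := by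
    rw [le_div_iff₀ hθ]
    calc 10 ^ 15 * (N * Real.log (1 / δ)) * θ
        = (10 ^ 15 * δ⁻¹ ^ 2 * N * θ * Real.log (1 / δ)) * δ ^ 2 := by field_simp
      _ ≤ L * δ ^ 2 := by gcongr
  have hLinv : 10 ^ 15 ≤ L * δ ^ 2 := by
    rw [le_div_iff₀ hθ] at hA
    have : 1 ≤ (N * θ) * Real.log (1 / δ) := by nlinarith
    nlinarith
  have hlL : 0.69 ≤ Real.log L := by
    have := Real.log_two_gt_d9
    have := Real.log_le_log (by norm_num) hLr
    linarith
  set t := 16 * (N * θ * Real.log L) with ht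
  have hsqt : √t ^ 3 = 64 * √(N * θ * Real.log L) ^ 3 := by
    rw [ht, Real.sqrt_mul (by norm_num), show (16:ℝ) = 4 ^ 2 by norm_num,
      Real.sqrt_sq (by norm_num), mul_pow]
    norm_num
  have hR : δ * √t ^ 3 ≤ 64 / 10000 * θ := by rw [hsqt]; linarith
  have hLN : Real.log L ≤ N * θ * Real.log L := by nlinarith
  have hNL : N * θ ≤ 2 * (N * θ * Real.log L) := by nlinarith
  have hexpL : exp (- Real.log L) = 1 / L := by rw [Real.exp_neg, Real.exp_log hL0]; simp
  -- net
  set M := ⌈N / δ ^ 2⌉₊ with hM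
  have hMge : N / δ ^ 2 ≤ M := Nat.le_ceil _
  have hMlt : (M:ℝ) < N / δ ^ 2 + 1 := Nat.ceil_lt_add_one (by positivity)
  have hM0 : (0:ℝ) < M := lt_of_lt_of_le (by positivity) hMge
  have hM0' : 0 < M := by exact_mod_cast hM0
  obtain ⟨S, hScard, hS1, hSnet⟩ := net N M hM0'
  have hcard : (S.card : ℝ) ≤ (δ⁻¹ ^ 3) ^ N := by
    have h1 : (S.card : ℝ) ≤ (2 * M + 1) ^ N := by exact_mod_cast hScard
    refine h1.trans ?_
    gcongr
    have h2 : 1 ≤ N / δ ^ 2 := by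
      rw [le_div_iff₀ (by positivity)]; nlinarith
    have h3 : 5 * (N / δ ^ 2) ≤ δ⁻¹ ^ 3 := by
      have : δ⁻¹ ^ 3 = δ⁻¹ / δ ^ 2 := by field_simp
      rw [this, ← mul_div_assoc]
      gcongr
      rw [← one_div, le_div_iff₀ hδ0]; linarith
    linarith
  have hprob := goodEv_prob hθ hθ1' N L (t := t) (τ := δ / 20) (by positivity) (by linarith) S hS1
  have hP1 : L * exp (N * θ - 3 / 8 * t) ≤ 1 / (2 * L) := by
    have : exp (N * θ - 3 / 8 * t) ≤ (1 / L) ^ 3 := by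
      rw [← hexpL, ← exp_nat_mul]
      apply exp_le_exp.mpr
      push_cast
      rw [ht]; linarith
    calc L * exp (N * θ - 3 / 8 * t) ≤ L * (1 / L) ^ 3 := by gcongr
      _ ≤ 1 / (2 * L) := by
        rw [le_div_iff₀ (by positivity)]
        field_simp
        linarith
  have hP2 := count_bound (K := S.card) hN hθ hθ2 hδ0 hNδ (by omega) hA hl hcard (by positivity)
  have hbad : (bgSamples θ N L).real (goodEv θ N L t (δ / 20) S)ᶜ ≤ 1 / L := by
    refine (hprob.trans (add_le_add hP1 hP2)).trans (le_of_eq ?_)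
    field_simp; norm_num
  have hpm := bgSamples_isProb hθ.le hθ1' N L
  have hgood : ENNReal.ofReal (1 - 1 / (L:ℝ)) ≤ bgSamples θ N L (goodEv θ N L t (δ / 20) S) := by
    have h1 := measure_univ_le_add_compl (μ := bgSamples θ N L) (goodEv θ N L t (δ / 20) S)
    rw [measure_univ] at h1
    have h2 : bgSamples θ N L (goodEv θ N L t (δ / 20) S)ᶜ ≤ ENNReal.ofReal (1 / L) :=
      ENNReal.le_ofReal_iff_toReal_le (measure_ne_top _ _) (by positivity) |>.mpr hbad
    rw [ENNReal.ofReal_sub _ (by positivity), ENNReal.ofReal_one]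
    exact tsub_le_iff_right.mpr (h1.trans (by gcongr))
  refine hgood.trans (measure_mono fun ω hω => ?_)
  have hdev : ∀ d : Fin N → ℝ, qn d ≤ 1 → ∀ n,
      |∑ i, Ff d n (ω i) - L * ∫ x, Ff d n x ∂(bgPi θ N)| ≤ L * (δ / 5) := by
    intro d hd n
    refine (uniform_dev hθ hθ1' S hS1 hSnet ω hω d hd n).trans ?_
    gcongr
    have hb1 : 2 * (N / M) * √t ^ 3 ≤ δ / 20 := by
      have : (N:ℝ) / M ≤ δ ^ 2 := by
        rw [div_le_iff₀ hM0]
        rw [div_le_iff₀ (by positivity)] at hMge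
        linarith
      calc 2 * (N / M) * √t ^ 3 ≤ 2 * δ ^ 2 * √t ^ 3 := by gcongr
        _ = 2 * δ * (δ * √t ^ 3) := by ring
        _ ≤ 2 * δ * (64 / 10000 * θ) := by gcongr
        _ ≤ δ / 20 := by nlinarith
    have hb2 : 128 * exp (N * θ - t / 4) ≤ δ / 20 := by
      have : exp (N * θ - t / 4) ≤ 1 / L := by
        rw [← hexpL]
        apply exp_le_exp.mpr
        rw [ht]; linarith
      have h2 : 1 / (L:ℝ) ≤ δ ^ 2 / 10 ^ 15 := by
        rw [div_le_div_iff₀ hL0 (by positivity)]; linarith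
      nlinarith
    linarith
  intro n s _ d hd n' hne hn'
  exact final_ineq hθ hθ1' (by omega) hζ.1 hδ0 ω hdev n n' d hd hne hn'
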